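/- Let f = h + conj(g) be a sense-preserving univalent harmonic self-mapping of the unit disk 𝔻. Then for every r with 0 < r < 1, ∫_{|z|<r} (|h'(z)|² − |g'(z)|²) dA(z) ≤ π r². -/

import Mathlib

open MeasureTheory Metric Complex

theorem Real.volume_add_volume_le_of_isCompact {A B C : Set ℝ} (hA : IsCompact A) (hB : IsCompact B)
    (hA0 : A.Nonempty) (hB0 : B.Nonempty) (hC : ∀ a ∈ A, ∀ b ∈ B, a + b ∈ C) :
    volume A + volume B ≤ volume C := by
  obtain ⟨m, hmB, hm⟩ := hB.exists_isLeast hB0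
  obtain ⟨M, hMA, hM⟩ := hA.exists_isGreatest hA0
  have h1 : volume ((fun x => x + m) '' A) = volume A := by
    simp
  have h2 : volume ((fun x => M + x) '' B) = volume B := by
    simp
  have hmeas : MeasurableSet ((fun x => M + x) '' B) :=
    (hB.image (by fun_prop)).measurableSet
  have hdisj : AEDisjoint volume ((fun x => x + m) '' A) ((fun x => M + x) '' B) := by
    refine measure_mono_null (t := {M + m}) ?_ (by simp)
    rintro _ ⟨⟨a, ha, rfl⟩, ⟨b, hb, hab⟩⟩
    have := hM ha
    have := hm hb
    simp only at hab
    simp only [Set.mem_singleton_iff]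
    linarith
  rw [← h1, ← h2, ← measure_union₀ hmeas.nullMeasurableSet hdisj]
  refine measure_mono ?_
  rintro _ (⟨a, ha, rfl⟩ | ⟨b, hb, rfl⟩)
  · exact hC a ha m hmB
  · exact hC M hMA b hb

theorem Real.volume_add_volume_le {A B C : Set ℝ} (hA : MeasurableSet A) (hB : MeasurableSet B)
    (hA0 : A.Nonempty) (hB0 : B.Nonempty) (hC : ∀ a ∈ A, ∀ b ∈ B, a + b ∈ C) :
    volume A + volume B ≤ volume C := by
  obtain ⟨a₀, ha₀⟩ := hA0
  obtain ⟨b₀, hb₀⟩ := hB0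
  rw [hA.measure_eq_iSup_isCompact, hB.measure_eq_iSup_isCompact]
  simp only [iSup_and']
  refine ENNReal.biSup_add_biSup_le' ⟨∅, by simp⟩ ⟨∅, by simp⟩ ?_
  rintro K ⟨hKA, hK⟩ L ⟨hLB, hL⟩
  calc volume K + volume L ≤ volume (insert a₀ K) + volume (insert b₀ L) := by
        gcongr <;> exact Set.subset_insert _ _
    _ ≤ volume C := by
        refine volume_add_volume_le_of_isCompact (hK.insert a₀) (hL.insert b₀)
          (Set.insert_nonempty _ _) (Set.insert_nonempty _ _) fun a ha b hb => hC a ?_ b ?_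
        · exact Set.insert_subset ha₀ hKA ha
        · exact Set.insert_subset hb₀ hLB hb

/-- A Brunn–Minkowski type inequality for functions on the line: if `a`, `b`, `d` are
nonnegative bounded functions with `a x + b y ≤ d (x + y)` wherever `a x` and `b y` are positive,
then the integrals satisfy `4 v ≤ ∫ d` as soon as `v ≤ ∫ a` and `v ≤ ∫ b`. -/
theorem four_mul_le_lintegral_of_add_le {a b d : ℝ → ℝ} (ha : Measurable a) (hb : Measurable b)
    (hd : Measurable d) (ha0 : ∀ x, 0 ≤ a x) (hb0 : ∀ x, 0 ≤ b x) (hd0 : ∀ x, 0 ≤ d x)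
    (hab : BddAbove (Set.range a)) (hbb : BddAbove (Set.range b))
    (h : ∀ x y, 0 < a x → 0 < b y → a x + b y ≤ d (x + y)) {v : ENNReal}
    (hva : v ≤ ∫⁻ x, ENNReal.ofReal (a x)) (hvb : v ≤ ∫⁻ x, ENNReal.ofReal (b x)) :
    4 * v ≤ ∫⁻ x, ENNReal.ofReal (d x) := by
  rcases eq_or_ne v 0 with rfl | hv
  · simp
  have hex : ∀ {u : ℝ → ℝ}, v ≤ ∫⁻ x, ENNReal.ofReal (u x) → ∃ x, 0 < u x := by
    intro u hu
    by_contra! hc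
    simp [ENNReal.ofReal_of_nonpos (hc _), hv] at hu
  set α := ⨆ x, a x with hα
  set β := ⨆ x, b x with hβ
  have hα0 : 0 < α := by
    obtain ⟨x, hx⟩ := hex hva
    exact hx.trans_le (le_ciSup hab x)
  have hβ0 : 0 < β := by
    obtain ⟨x, hx⟩ := hex hvb
    exact hx.trans_le (le_ciSup hbb x)
  have key : ∀ t ∈ Set.Ioi (0 : ℝ), volume {x | t < a x / α} + volume {x | t < b x / β}
      ≤ volume {x | t < d x / (α + β)} := by
    intro t ht
    simp only [Set.mem_Ioi] at ht
    simp only [lt_div_iff₀ hα0, lt_div_iff₀ hβ0, lt_div_iff₀ (add_pos hα0 hβ0)]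
    rcases lt_or_ge t 1 with ht1 | ht1
    · refine Real.volume_add_volume_le (measurableSet_lt measurable_const ha)
        (measurableSet_lt measurable_const hb) ?_ ?_ ?_
      · exact exists_lt_of_lt_ciSup (show t * α < α by nlinarith)
      · exact exists_lt_of_lt_ciSup (show t * β < β by nlinarith)
      · intro x hx y hy
        simp only [Set.mem_ofPred_eq] at hx hy ⊢
        have := h x y ((mul_pos ht hα0).trans hx) ((mul_pos ht hβ0).trans hy)
        linarith
    · have e1 : {x | t * α < a x} = ∅ := by
        ext x
        have : a x ≤ α := le_ciSup hab x
        simp only [Set.mem_ofPred_eq, Set.mem_empty_iff_false, iff_false, not_lt]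
        nlinarith
      have e2 : {x | t * β < b x} = ∅ := by
        ext x
        have : b x ≤ β := le_ciSup hbb x
        simp only [Set.mem_ofPred_eq, Set.mem_empty_iff_false, iff_false, not_lt]
        nlinarith
      simp [e1, e2]
  have layer : ∀ {u : ℝ → ℝ} {c : ℝ}, Measurable u → (∀ x, 0 ≤ u x) → 0 < c →
      ∫⁻ t in Set.Ioi (0 : ℝ), volume {x | t < u x / c}
        = ENNReal.ofReal c⁻¹ * ∫⁻ x, ENNReal.ofReal (u x) := by
    intro u c hu hu0 hc
    rw [← lintegral_eq_lintegral_meas_lt volume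
      (Filter.Eventually.of_forall fun x => div_nonneg (hu0 x) hc.le)
      (hu.div_const c).aemeasurable, ← lintegral_const_mul _ hu.ennreal_ofReal]
    refine lintegral_congr fun x => ?_
    rw [div_eq_inv_mul, ENNReal.ofReal_mul (by positivity)]
  have hanti : Antitone fun t : ℝ => volume {x | t < a x / α} := fun s t hst =>
    measure_mono fun x hx => lt_of_le_of_lt hst hx
  have main := setLIntegral_mono' (μ := volume) measurableSet_Ioi key
  rw [lintegral_add_left hanti.measurable, layer ha ha0 hα0, layer hb hb0 hβ0,
    layer hd hd0 (add_pos hα0 hβ0)] at main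
  have h1 : ENNReal.ofReal α⁻¹ * v + ENNReal.ofReal β⁻¹ * v
      ≤ ENNReal.ofReal (α + β)⁻¹ * ∫⁻ x, ENNReal.ofReal (d x) :=
    le_trans (by gcongr) main
  have h2 : ENNReal.ofReal ((α + β) * (α⁻¹ + β⁻¹)) * v ≤ ∫⁻ x, ENNReal.ofReal (d x) := by
    calc _ = ENNReal.ofReal (α + β) * (ENNReal.ofReal α⁻¹ * v + ENNReal.ofReal β⁻¹ * v) := by
          rw [ENNReal.ofReal_mul (by positivity), ENNReal.ofReal_add (p := α⁻¹) (by positivity)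
            (by positivity)]
          ring
      _ ≤ ENNReal.ofReal (α + β) *
          (ENNReal.ofReal (α + β)⁻¹ * ∫⁻ x, ENNReal.ofReal (d x)) := by gcongr
      _ = ∫⁻ x, ENNReal.ofReal (d x) := by
          rw [← mul_assoc, ← ENNReal.ofReal_mul (by positivity),
            mul_inv_cancel₀ (by positivity), ENNReal.ofReal_one, one_mul]
  refine le_trans ?_ h2
  gcongr
  rw [show (4 : ENNReal) = ENNReal.ofReal 4 by simp]
  refine ENNReal.ofReal_le_ofReal ?_
  have : (α + β) * (α⁻¹ + β⁻¹) = 4 + (α - β) ^ 2 / (α * β) := by field_simp; ring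
  rw [this]
  have : 0 ≤ (α - β) ^ 2 / (α * β) := by positivity
  linarith

open scoped Pointwise in
/-- A Brunn–Minkowski inequality in the plane. -/
theorem four_mul_le_volume_add {A B : Set (ℝ × ℝ)} (hA : IsCompact A) (hB : IsCompact B)
    {v : ENNReal} (hvA : v ≤ volume A) (hvB : v ≤ volume B) : 4 * v ≤ volume (A + B) := by
  have hD := hA.add hB
  have slice : ∀ {K : Set (ℝ × ℝ)}, IsCompact K →
      ∃ M : ENNReal, M ≠ ⊤ ∧ ∀ x, volume (Prod.mk x ⁻¹' K) ≤ M := by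
    intro K hK
    refine ⟨volume (Prod.snd '' K), (hK.image continuous_snd).measure_lt_top.ne, fun x => ?_⟩
    exact measure_mono fun y hy => ⟨(x, y), hy, rfl⟩
  have hne : ∀ {K : Set (ℝ × ℝ)}, IsCompact K → ∀ x, volume (Prod.mk x ⁻¹' K) ≠ ⊤ := by
    intro K hK x
    obtain ⟨M, hM, hMx⟩ := slice hK
    exact ne_top_of_le_ne_top hM (hMx x)
  have hvol : ∀ {K : Set (ℝ × ℝ)}, IsCompact K →
      volume K = ∫⁻ x, ENNReal.ofReal (volume (Prod.mk x ⁻¹' K)).toReal := by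
    intro K hK
    rw [Measure.volume_eq_prod, Measure.prod_apply hK.measurableSet]
    exact lintegral_congr fun x => (ENNReal.ofReal_toReal (hne hK x)).symm
  have hmeas : ∀ {K : Set (ℝ × ℝ)}, IsCompact K →
      Measurable fun x => (volume (Prod.mk x ⁻¹' K)).toReal := fun hK =>
    (measurable_measure_prodMk_left hK.measurableSet).ennreal_toReal
  have hbdd : ∀ {K : Set (ℝ × ℝ)}, IsCompact K →
      BddAbove (Set.range fun x => (volume (Prod.mk x ⁻¹' K)).toReal) := by
    intro K hK
    obtain ⟨M, hM, hMx⟩ := slice hK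
    refine ⟨M.toReal, ?_⟩
    rintro _ ⟨x, rfl⟩
    exact ENNReal.toReal_mono hM (hMx x)
  rw [hvol hA] at hvA
  rw [hvol hB] at hvB
  rw [hvol hD]
  refine four_mul_le_lintegral_of_add_le (hmeas hA) (hmeas hB) (hmeas hD)
    (fun _ => ENNReal.toReal_nonneg) (fun _ => ENNReal.toReal_nonneg)
    (fun _ => ENNReal.toReal_nonneg) (hbdd hA) (hbdd hB) ?_ hvA hvB
  intro x y hx hy
  have nonempty : ∀ {s : Set ℝ}, 0 < (volume s).toReal → s.Nonempty := fun hs =>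
    nonempty_of_measure_ne_zero (ENNReal.toReal_pos_iff.1 hs).1.ne'
  rw [← ENNReal.toReal_add (hne hA x) (hne hB y)]
  refine ENNReal.toReal_mono (hne hD _) ?_
  refine Real.volume_add_volume_le (hA.measurableSet.preimage measurable_prodMk_left)
    (hB.measurableSet.preimage measurable_prodMk_left) (nonempty hx) (nonempty hy) ?_
  intro s hs t ht
  exact Set.mem_add.2 ⟨(x, s), hs, (y, t), ht, rfl⟩

open scoped Pointwise in
theorem Complex.four_mul_le_volume_add {A B : Set ℂ} (hA : IsCompact A) (hB : IsCompact B)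
    {v : ENNReal} (hvA : v ≤ volume A) (hvB : v ≤ volume B) : 4 * v ≤ volume (A + B) := by
  have himg : ∀ K : Set ℂ, volume (equivRealProdCLM '' K) = volume K := fun K => by
    have := Complex.volume_preserving_equiv_real_prod.symm.measure_preimage_equiv K
    rw [← this]
    congr 1
    exact equivRealProdCLM.toEquiv.image_eq_preimage_symm K
  rw [← himg] at hvA hvB
  rw [← himg, Set.image_add]
  exact _root_.four_mul_le_volume_add (hA.image equivRealProdCLM.continuous)
    (hB.image equivRealProdCLM.continuous) hvA hvB

open scoped Pointwise in
theorem Complex.le_volume_midpoints {A B : Set ℂ} (hA : IsCompact A) (hB : IsCompact B)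
    {v : ENNReal} (hvA : v ≤ volume A) (hvB : v ≤ volume B) :
    v ≤ volume ((2⁻¹ : ℝ) • (A + B)) := by
  have h4 := Complex.four_mul_le_volume_add hA hB hvA hvB
  rw [Measure.addHaar_smul, Complex.finrank_real_complex]
  calc v = ENNReal.ofReal |(2⁻¹ : ℝ) ^ 2| * (4 * v) := by
        rw [← mul_assoc, show (4 : ENNReal) = ENNReal.ofReal 4 by simp,
          ← ENNReal.ofReal_mul (by positivity)]
        norm_num
    _ ≤ _ := by gcongr

theorem norm_sub_pos_of_mem_sphere {R : ℝ} {z ζ : ℂ} (hz : ‖z‖ < R) (hζ : ζ ∈ sphere (0 : ℂ) |R|) :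
    0 < ‖ζ - z‖ := by
  rw [norm_sub_pos_iff]
  rintro rfl
  rw [mem_sphere_zero_iff_norm, abs_of_pos ((norm_nonneg _).trans_lt hz)] at hζ
  exact hz.ne hζ

theorem poissonKernel_zero_eq {R : ℝ} {z ζ : ℂ} (hζ : ζ ∈ sphere (0 : ℂ) |R|) :
    poissonKernel 0 z ζ = (R ^ 2 - ‖z‖ ^ 2) / ‖ζ - z‖ ^ 2 := by
  rw [mem_sphere_zero_iff_norm] at hζ
  simp [poissonKernel_def, hζ]

theorem sq_sub_sq_norm_pos {R : ℝ} {z : ℂ} (hz : ‖z‖ < R) : 0 < R ^ 2 - ‖z‖ ^ 2 := by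
  nlinarith [norm_nonneg z]

theorem poissonKernel_zero_pos {R : ℝ} {z ζ : ℂ} (hz : ‖z‖ < R) (hζ : ζ ∈ sphere (0 : ℂ) |R|) :
    0 < poissonKernel 0 z ζ := by
  rw [poissonKernel_zero_eq hζ]
  have := sq_sub_sq_norm_pos hz
  have := norm_sub_pos_of_mem_sphere hz hζ
  positivity

theorem continuousOn_poissonKernel_zero {R : ℝ} {z : ℂ} (hz : ‖z‖ < R) :
    ContinuousOn (poissonKernel 0 z) (sphere (0 : ℂ) |R|) := by
  have : ContinuousOn (fun ζ : ℂ => (R ^ 2 - ‖z‖ ^ 2) / ‖ζ - z‖ ^ 2) (sphere (0 : ℂ) |R|) := by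
    refine ContinuousOn.div (by fun_prop) (by fun_prop) fun ζ hζ => ?_
    have := norm_sub_pos_of_mem_sphere hz hζ
    positivity
  exact this.congr fun ζ hζ => poissonKernel_zero_eq hζ

theorem circleAverage_poissonKernel_mul_re {F : ℂ → ℂ} (hF : DifferentiableOn ℂ F (ball 0 1))
    {R : ℝ} (hR0 : 0 < R) (hR1 : R < 1) {z : ℂ} (hz : ‖z‖ < R) :
    Real.circleAverage (fun ζ => poissonKernel 0 z ζ * (F ζ).re) 0 R = (F z).re := by
  have hcl : closedBall (0 : ℂ) R ⊆ ball 0 1 := closedBall_subset_ball hR1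
  have hd : DiffContOnCl ℂ F (ball 0 R) := by
    refine DifferentiableOn.diffContOnCl (hF.mono ?_)
    rwa [closure_ball _ hR0.ne']
  rw [← hd.circleAverage_poissonKernel_smul (by simpa using hz), ← reCLM_apply,
    ← reCLM.circleAverage_comp_comm]
  · congr 1
    ext ζ
    simp
  · refine ContinuousOn.circleIntegrable' ((continuousOn_poissonKernel_zero hz).smul ?_)
    refine hF.continuousOn.mono (subset_trans ?_ hcl)
    rw [abs_of_pos hR0]
    exact sphere_subset_closedBall

theorem circleAverage_log_poissonKernel {R : ℝ} (hR0 : 0 < R) {z : ℂ} (hz : ‖z‖ < R) :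
    Real.circleAverage (fun ζ => Real.log (poissonKernel 0 z ζ)) 0 R
      = Real.log (1 - (‖z‖ / R) ^ 2) := by
  have h1 : Set.EqOn (fun ζ => Real.log (poissonKernel 0 z ζ))
      ((fun _ => Real.log (R ^ 2 - ‖z‖ ^ 2)) - (2 : ℝ) • fun ζ => Real.log ‖ζ - z‖)
      (sphere 0 |R|) := by
    intro ζ hζ
    have := norm_sub_pos_of_mem_sphere hz hζ
    simp only [poissonKernel_zero_eq hζ]
    rw [Real.log_div (sq_sub_sq_norm_pos hz).ne' (by positivity), Real.log_pow]
    simp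
  have hint : CircleIntegrable (fun ζ => Real.log ‖ζ - z‖) 0 R := by
    refine ContinuousOn.circleIntegrable' (ContinuousOn.log (by fun_prop) fun ζ hζ => ?_)
    exact (norm_sub_pos_of_mem_sphere hz hζ).ne'
  rw [Real.circleAverage_congr_sphere h1, Real.circleAverage_sub (circleIntegrable_const _ _ _)
    (hint.const_smul), Real.circleAverage_const, Real.circleAverage_smul,
    circleAverage_log_norm_sub_const_of_mem_closedBall]
  · have : 1 - (‖z‖ / R) ^ 2 = (R ^ 2 - ‖z‖ ^ 2) / R ^ 2 := by field_simp
    rw [this, Real.log_div (sq_sub_sq_norm_pos hz).ne' (by positivity), Real.log_pow]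
    simp
  · rw [abs_of_pos hR0]
    simpa using hz.le

theorem two_mul_mul_re_le {ρ P : ℝ} (hρ0 : 0 < ρ) (hρ1 : ρ < 1) (hP : 0 < P) {u : ℂ}
    (hu : ‖u‖ ≤ 1) :
    2 * ρ * (P * u.re) - (1 + ρ ^ 2) * P + (1 - ρ ^ 2) * Real.log P
      ≤ (1 - ρ ^ 2) * (Real.log (1 - ρ ^ 2) - 1 - 2 * Real.log ‖1 - ρ * u‖) := by
  set b := 1 + ρ ^ 2 - 2 * ρ * u.re with hb
  have hρ2 : 0 < 1 - ρ ^ 2 := by nlinarith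
  have hre : u.re ≤ 1 := (re_le_norm u).trans hu
  have hb0 : 0 < b := by nlinarith
  have hpos : 0 < ‖1 - ρ * u‖ := by
    rw [norm_sub_pos_iff]
    intro h
    have := congrArg norm h
    rw [norm_one, norm_mul, norm_real, Real.norm_of_nonneg hρ0.le] at this
    nlinarith [norm_nonneg u]
  have hlogb : 2 * Real.log ‖1 - ρ * u‖ ≤ Real.log b := by
    have h2 : ((2 : ℕ) : ℝ) * Real.log ‖1 - ρ * u‖ = Real.log (‖1 - ρ * u‖ ^ 2) :=
      (Real.log_pow _ _).symm
    push_cast at h2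
    rw [h2]
    refine Real.log_le_log (by positivity) ?_
    have h3 : ‖u‖ ^ 2 ≤ 1 := pow_le_one₀ (norm_nonneg _) hu
    rw [← normSq_eq_norm_sq, normSq_apply] at h3 ⊢
    simp only [sub_re, sub_im, one_re, one_im, re_ofReal_mul, im_ofReal_mul]
    nlinarith [sq_nonneg ρ]
  have hlog : Real.log b + Real.log P - Real.log (1 - ρ ^ 2) ≤ b * P / (1 - ρ ^ 2) - 1 := by
    rw [← Real.log_mul hb0.ne' hP.ne', ← Real.log_div (by positivity) hρ2.ne']
    exact Real.log_le_sub_one_of_pos (by positivity)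
  have h4 : (1 - ρ ^ 2) * (2 * Real.log ‖1 - ρ * u‖ + Real.log P - Real.log (1 - ρ ^ 2) + 1)
      ≤ b * P := by
    calc _ ≤ (1 - ρ ^ 2) * (b * P / (1 - ρ ^ 2)) := by
          refine mul_le_mul_of_nonneg_left ?_ hρ2.le
          linarith
      _ = b * P := by field_simp
  rw [hb] at h4
  linarith

/-- A bound for sums of rotated values of a harmonic self-map of the unit disk, in terms of a lower
bound `δ` for `∏ i, (1 - η i * x)`. -/
theorem sum_re_mul_le {h g f : ℂ → ℂ} (hh : DifferentiableOn ℂ h (ball (0 : ℂ) 1))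
    (hg : DifferentiableOn ℂ g (ball (0 : ℂ) 1))
    (hf : f = fun z => h z + (starRingEnd ℂ) (g z))
    (hself : Set.MapsTo f (ball (0 : ℂ) 1) (ball (0 : ℂ) 1))
    {R ρ : ℝ} (hR0 : 0 < R) (hR1 : R < 1) (hρ0 : 0 < ρ) (hρ1 : ρ < 1)
    {ι : Type*} [Fintype ι] {η z : ι → ℂ} (hη : ∀ i, ‖η i‖ = 1) (hz : ∀ i, ‖z i‖ ≤ R * ρ)
    {δ : ℝ} (hδ : 0 < δ) (hprod : ∀ x : ℂ, ‖x‖ ≤ ρ → δ ≤ ‖∏ i, (1 - η i * x)‖) :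
    ρ * ∑ i, (η i * f (z i)).re ≤ Fintype.card ι * ρ ^ 2 - (1 - ρ ^ 2) * Real.log δ := by
  have hρ2 : 0 < 1 - ρ ^ 2 := by nlinarith
  have hzR : ∀ i, ‖z i‖ < R := fun i => (hz i).trans_lt (by nlinarith)
  have hsph : sphere (0 : ℂ) |R| ⊆ ball 0 1 := by
    rw [abs_of_pos hR0]
    exact sphere_subset_closedBall.trans (closedBall_subset_ball hR1)
  let F : ι → ℂ → ℂ := fun i w => η i * h w + (starRingEnd ℂ) (η i) * g w
  have hF : ∀ i, DifferentiableOn ℂ (F i) (ball 0 1) := fun i =>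
    (hh.const_mul _).add (hg.const_mul _)
  have hFre : ∀ i w, (η i * f w).re = (F i w).re := by
    intro i w
    simp [F, hf]
    ring
  let G : ι → ℂ → ℝ := fun i => ((2 * ρ) • (fun ζ => poissonKernel 0 (z i) ζ * (F i ζ).re)
    - (1 + ρ ^ 2) • fun ζ => poissonKernel 0 (z i) ζ * ((fun _ => (1 : ℂ)) ζ).re)
    + (1 - ρ ^ 2) • fun ζ => Real.log (poissonKernel 0 (z i) ζ)
  have hi1 : ∀ i, ∀ {H : ℂ → ℂ}, DifferentiableOn ℂ H (ball 0 1) →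
      CircleIntegrable (fun ζ => poissonKernel 0 (z i) ζ * (H ζ).re) 0 R := by
    intro i H hH
    refine ContinuousOn.circleIntegrable' ((continuousOn_poissonKernel_zero (hzR i)).mul ?_)
    exact continuous_re.comp_continuousOn (hH.continuousOn.mono hsph)
  have hi2 : ∀ i, CircleIntegrable (fun ζ => Real.log (poissonKernel 0 (z i) ζ)) 0 R := fun i =>
    ContinuousOn.circleIntegrable' ((continuousOn_poissonKernel_zero (hzR i)).log
      fun ζ hζ => (poissonKernel_zero_pos (hzR i) hζ).ne')
  have hone : DifferentiableOn ℂ (fun _ : ℂ => (1 : ℂ)) (ball 0 1) := by fun_prop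
  have hGint : ∀ i, CircleIntegrable (G i) 0 R := fun i =>
    (((hi1 i (hF i)).const_smul).sub ((hi1 i hone).const_smul)).add ((hi2 i).const_smul)
  have hGavg : ∀ i, Real.circleAverage (G i) 0 R = 2 * ρ * (η i * f (z i)).re - (1 + ρ ^ 2)
      + (1 - ρ ^ 2) * Real.log (1 - (‖z i‖ / R) ^ 2) := by
    intro i
    simp only [G]
    rw [Real.circleAverage_add (((hi1 i (hF i)).const_smul).sub ((hi1 i hone).const_smul))
      ((hi2 i).const_smul), Real.circleAverage_sub ((hi1 i (hF i)).const_smul)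
      ((hi1 i hone).const_smul)]
    rw [Real.circleAverage_smul, Real.circleAverage_smul, Real.circleAverage_smul,
      circleAverage_poissonKernel_mul_re (hF i) hR0 hR1 (hzR i),
      circleAverage_poissonKernel_mul_re hone hR0 hR1 (hzR i),
      circleAverage_log_poissonKernel hR0 (hzR i), hFre]
    simp
  have hle : ∀ ζ ∈ sphere (0 : ℂ) |R|, ∑ i, G i ζ
      ≤ (1 - ρ ^ 2) * (Fintype.card ι * (Real.log (1 - ρ ^ 2) - 1) - 2 * Real.log δ) := by
    intro ζ hζ
    have hfζ : ‖f ζ‖ ≤ 1 := (mem_ball_zero_iff.1 (hself (hsph hζ))).le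
    have hu : ∀ i, ‖η i * f ζ‖ ≤ 1 := fun i => by simpa [hη i] using hfζ
    have hx : ‖(ρ : ℂ) * f ζ‖ ≤ ρ := by
      rw [norm_mul, norm_real, Real.norm_of_nonneg hρ0.le]
      nlinarith
    have hp := hprod _ hx
    have hlogp : Real.log δ ≤ ∑ i, Real.log ‖1 - ρ * (η i * f ζ)‖ := by
      rw [← Real.log_prod]
      · refine (Real.log_le_log hδ hp).trans_eq ?_
        rw [norm_prod]
        congr 1
        refine Finset.prod_congr rfl fun i _ => ?_
        congr 2
        ring
      · intro i _ h0
        have : ∏ i, (1 - η i * (ρ * f ζ)) = 0 := by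
          refine Finset.prod_eq_zero (Finset.mem_univ i) ?_
          rw [← norm_eq_zero, ← h0]
          congr 2
          ring
        rw [this, norm_zero] at hp
        exact hδ.not_ge hp
    calc ∑ i, G i ζ ≤ ∑ i, (1 - ρ ^ 2) * (Real.log (1 - ρ ^ 2) - 1
          - 2 * Real.log ‖1 - ρ * (η i * f ζ)‖) := by
          refine Finset.sum_le_sum fun i _ => ?_
          have := two_mul_mul_re_le hρ0 hρ1 (poissonKernel_zero_pos (hzR i) hζ) (hu i)
          rw [hFre] at this
          simpa [G] using this
      _ = (1 - ρ ^ 2) * (Fintype.card ι * (Real.log (1 - ρ ^ 2) - 1)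
          - 2 * ∑ i, Real.log ‖1 - ρ * (η i * f ζ)‖) := by
          rw [← Finset.mul_sum, Finset.sum_sub_distrib, ← Finset.mul_sum, Finset.sum_const,
            Finset.card_univ, nsmul_eq_mul]
      _ ≤ _ := by
          refine mul_le_mul_of_nonneg_left ?_ hρ2.le
          linarith
  have havg := Real.circleAverage_mono_on_of_le_circle
    (CircleIntegrable.fun_sum Finset.univ fun i _ => hGint i) hle
  rw [Real.circleAverage_fun_sum fun i _ => hGint i] at havg
  have hlow : ∑ i, (2 * ρ * (η i * f (z i)).re - (1 + ρ ^ 2)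
      + (1 - ρ ^ 2) * Real.log (1 - ρ ^ 2)) ≤ ∑ i, Real.circleAverage (G i) 0 R := by
    refine Finset.sum_le_sum fun i _ => ?_
    rw [hGavg]
    gcongr
    rw [div_le_iff₀ hR0, mul_comm]
    exact hz i
  have hsum := hlow.trans havg
  rw [Finset.sum_add_distrib, Finset.sum_sub_distrib, ← Finset.mul_sum] at hsum
  simp only [Finset.sum_const, Finset.card_univ, nsmul_eq_mul] at hsum
  linarith

/-- The real Jacobian determinant of `w ↦ a w + conj (b w)`. -/
theorem det_add_conj (a b : ℂ) :
    (a • (1 : ℂ →L[ℝ] ℂ) + (conjCLE : ℂ →L[ℝ] ℂ) ∘L (b • (1 : ℂ →L[ℝ] ℂ))).det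
      = ‖a‖ ^ 2 - ‖b‖ ^ 2 := by
  rw [ContinuousLinearMap.det, ← LinearMap.det_toMatrix basisOneI, Matrix.det_fin_two]
  simp only [LinearMap.toMatrix_apply]
  rw [← normSq_eq_norm_sq, ← normSq_eq_norm_sq, normSq_apply, normSq_apply]
  simp [basisOneI]
  ring

theorem lintegral_jacobian_eq_volume_image {h g f : ℂ → ℂ} {s : Set ℂ} (hs : IsOpen s)
    (hh : DifferentiableOn ℂ h s) (hg : DifferentiableOn ℂ g s)
    (hf : f = fun z => h z + (starRingEnd ℂ) (g z)) (hinj : Set.InjOn f s)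
    (hsp : ∀ z ∈ s, ‖deriv g z‖ < ‖deriv h z‖) :
    (∫⁻ z in s, ENNReal.ofReal (‖deriv h z‖ ^ 2 - ‖deriv g z‖ ^ 2)) = volume (f '' s) := by
  have hder : ∀ z ∈ s, HasFDerivWithinAt f (deriv h z • (1 : ℂ →L[ℝ] ℂ)
      + (conjCLE : ℂ →L[ℝ] ℂ) ∘L (deriv g z • (1 : ℂ →L[ℝ] ℂ))) s z := by
    intro z hz
    have h1 := (hh.differentiableAt (hs.mem_nhds hz)).hasDerivAt.complexToReal_fderiv
    have h2 := (hg.differentiableAt (hs.mem_nhds hz)).hasDerivAt.complexToReal_fderiv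
    rw [hf]
    exact (h1.add ((conjCLE : ℂ →L[ℝ] ℂ).hasFDerivAt.comp z h2)).hasFDerivWithinAt
  rw [← lintegral_abs_det_fderiv_eq_addHaar_image volume hs.measurableSet hder hinj]
  refine setLIntegral_congr_fun hs.measurableSet fun z hz => ?_
  simp only [det_add_conj]
  rw [abs_of_nonneg]
  have := hsp z hz
  nlinarith [norm_nonneg (deriv g z)]

theorem Complex.volume_image_mul_of_norm_eq_one {c : ℂ} (hc : ‖c‖ = 1) (s : Set ℂ) :
    volume ((fun w => c * w) '' s) = volume s := by
  have h := (rotation ⟨c, mem_sphere_zero_iff_norm.2 hc⟩).symm.measurePreserving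
  rw [← h.measure_preimage_emb (rotation _).symm.toMeasurableEquiv.measurableEmbedding s,
    ← LinearIsometryEquiv.image_eq_preimage_symm]
  rfl

open scoped Pointwise in
/-- Averaging a compact set over the rotations by roots of unity of order `2 ^ m`
does not decrease the area. -/
theorem exists_rotation_average {S : Set ℂ} (hS : IsCompact S) (m : ℕ) :
    ∃ T : Set ℂ, IsCompact T ∧ volume S ≤ volume T ∧ ∀ w ∈ T,
      ∃ (ι : Type) (_ : Fintype ι) (η y : ι → ℂ), Fintype.card ι = 2 ^ m ∧ (∀ i, ‖η i‖ = 1) ∧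
        (∀ i, y i ∈ S) ∧ (∀ x : ℂ, ∏ i, (1 - η i * x) = 1 - x ^ 2 ^ m) ∧
        2 ^ m * w = ∑ i, η i * y i := by
  induction m with
  | zero =>
    refine ⟨S, hS, le_rfl, fun w hw => ⟨Unit, inferInstance, fun _ => 1, fun _ => w, ?_⟩⟩
    simp [hw]
  | succ m ih =>
    obtain ⟨T, hT, hvol, hmem⟩ := ih
    set ζ : ℂ := exp ((Real.pi / 2 ^ m : ℝ) * I) with hζ
    have hζn : ‖ζ‖ = 1 := norm_exp_ofReal_mul_I _
    have hζp : ζ ^ 2 ^ m = -1 := by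
      rw [hζ, ← exp_nat_mul, ← exp_pi_mul_I]
      congr 1
      push_cast
      field_simp
    have hT' : IsCompact ((fun w => ζ * w) '' T) := hT.image (by fun_prop)
    refine ⟨(2⁻¹ : ℝ) • (T + (fun w => ζ * w) '' T), (hT.add hT').smul _, ?_, ?_⟩
    · refine le_volume_midpoints hT hT' hvol ?_
      rwa [volume_image_mul_of_norm_eq_one hζn]
    · rintro _ ⟨_, ⟨u, hu, _, ⟨v, hv, rfl⟩, rfl⟩, rfl⟩
      obtain ⟨ι, _, η, y, hcard, hη, hy, hprod, hsum⟩ := hmem u hu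
      obtain ⟨κ, _, θ, x, hcard', hθ, hx, hprod', hsum'⟩ := hmem v hv
      refine ⟨ι ⊕ κ, inferInstance, Sum.elim η fun k => ζ * θ k, Sum.elim y x, ?_, ?_, ?_, ?_, ?_⟩
      · rw [Fintype.card_sum, hcard, hcard', pow_succ]
        ring
      · rintro (i | k)
        · exact hη i
        · simp [hζn, hθ k]
      · rintro (i | k)
        · exact hy i
        · exact hx k
      · intro w
        have h2 := hprod' (ζ * w)
        rw [mul_pow, hζp] at h2
        simp only [Fintype.prod_sum_type, Sum.elim_inl, Sum.elim_inr, hprod]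
        rw [show ∏ k, (1 - ζ * θ k * w) = ∏ k, (1 - θ k * (ζ * w)) from
          Finset.prod_congr rfl fun k _ => by ring, h2, pow_succ, pow_mul]
        ring
      · simp only [Fintype.sum_sum_type, Sum.elim_inl, Sum.elim_inr, mul_assoc, ← Finset.mul_sum,
          ← hsum, ← hsum', pow_succ, real_smul, ofReal_inv, ofReal_ofNat]
        field_simp

/-- Area bound for the image of a closed disk under a harmonic self-map of the unit disk. -/
theorem volume_image_closedBall_le {h g f : ℂ → ℂ} (hh : DifferentiableOn ℂ h (ball (0 : ℂ) 1))
    (hg : DifferentiableOn ℂ g (ball (0 : ℂ) 1))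
    (hf : f = fun z => h z + (starRingEnd ℂ) (g z))
    (hself : Set.MapsTo f (ball (0 : ℂ) 1) (ball (0 : ℂ) 1))
    {R ρ : ℝ} (hR0 : 0 < R) (hR1 : R < 1) (hρ0 : 0 < ρ) (hρ1 : ρ < 1) :
    volume (f '' closedBall 0 (R * ρ)) ≤ ENNReal.ofReal (Real.pi * ρ ^ 2) := by
  have hcont : ContinuousOn f (ball 0 1) := by
    rw [hf]
    exact hh.continuousOn.add (continuous_conj.comp_continuousOn hg.continuousOn)
  have hS : IsCompact (f '' closedBall 0 (R * ρ)) :=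
    (isCompact_closedBall _ _).image_of_continuousOn
      (hcont.mono (closedBall_subset_ball (by nlinarith)))
  let s : ℕ → ℝ := fun m => ρ - (1 - ρ ^ 2) / ρ * (Real.log (1 - ρ ^ 2 ^ m) / 2 ^ m)
  have hbound : ∀ m, volume (f '' closedBall 0 (R * ρ)) ≤ ENNReal.ofReal (Real.pi * s m ^ 2) := by
    intro m
    obtain ⟨T, -, hvol, hT⟩ := exists_rotation_average hS m
    have hρm : 0 < 1 - ρ ^ 2 ^ m := sub_pos.2 (pow_lt_one₀ hρ0.le hρ1 (by positivity))
    have hsub : T ⊆ closedBall 0 (s m) := by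
      intro w hw
      obtain ⟨ι, _, η, y, hcard, hη, hy, hprod, hsum⟩ := hT w hw
      choose z hz hzy using hy
      obtain ⟨c, hc, hcw⟩ : ∃ c : ℂ, ‖c‖ = 1 ∧ c * w = ‖w‖ := by
        rcases eq_or_ne w 0 with rfl | hw0
        · exact ⟨1, by simp⟩
        · have : (‖w‖ : ℂ) ≠ 0 := by simpa using hw0
          refine ⟨‖w‖ / w, ?_, by field_simp⟩
          rw [norm_div, norm_real, norm_norm, div_self (by simpa using hw0)]
      have key := sum_re_mul_le hh hg hf hself hR0 hR1 hρ0 hρ1 (η := fun i => c * η i) (z := z)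
        (fun i => by simp [hc, hη i]) (fun i => by simpa using hz i) hρm (fun x hx => by
          have := hprod (c * x)
          rw [show ∏ i, (1 - c * η i * x) = ∏ i, (1 - η i * (c * x)) from
            Finset.prod_congr rfl fun i _ => by ring, this]
          have h1 := norm_sub_norm_le 1 ((c * x) ^ 2 ^ m)
          rw [norm_one, norm_pow, norm_mul, hc, one_mul] at h1
          have h2 : ‖x‖ ^ 2 ^ m ≤ ρ ^ 2 ^ m := pow_le_pow_left₀ (norm_nonneg _) hx _
          linarith)
      rw [← re_sum] at key
      have hval : ∑ i, c * η i * f (z i) = ((2 ^ m * ‖w‖ : ℝ) : ℂ) := by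
        push_cast
        rw [← hcw, mul_left_comm, hsum, Finset.mul_sum]
        exact Finset.sum_congr rfl fun i _ => by rw [hzy]; ring
      rw [hval, ofReal_re, hcard] at key
      push_cast at key
      rw [mem_closedBall_zero_iff]
      have : ρ * 2 ^ m * s m = 2 ^ m * ρ ^ 2 - (1 - ρ ^ 2) * Real.log (1 - ρ ^ 2 ^ m) := by
        simp only [s]
        field_simp
      refine le_of_mul_le_mul_left (a := ρ * 2 ^ m) ?_ (by positivity)
      linarith
    refine hvol.trans ((measure_mono hsub).trans_eq ?_)
    have hs0 : 0 ≤ s m := by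
      have : Real.log (1 - ρ ^ 2 ^ m) ≤ 0 :=
        Real.log_nonpos hρm.le (by linarith [pow_pos hρ0 (2 ^ m)])
      have h1 : (1 - ρ ^ 2) / ρ * (Real.log (1 - ρ ^ 2 ^ m) / 2 ^ m) ≤ 0 :=
        mul_nonpos_of_nonneg_of_nonpos (div_nonneg (by nlinarith) hρ0.le)
          (div_nonpos_of_nonpos_of_nonneg this (by positivity))
      simp only [s]
      linarith
    rw [Complex.volume_closedBall, mul_comm Real.pi, ENNReal.ofReal_mul (by positivity),
      ENNReal.ofReal_pow hs0, ← NNReal.coe_real_pi, ENNReal.ofReal_coe_nnreal]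
  have hpow : Filter.Tendsto (fun m : ℕ => 2 ^ m) Filter.atTop Filter.atTop :=
    tendsto_pow_atTop_atTop_of_one_lt (by norm_num : 1 < 2)
  have hlog : Filter.Tendsto (fun m : ℕ => Real.log (1 - ρ ^ 2 ^ m)) Filter.atTop (nhds 0) := by
    have h1 : Filter.Tendsto (fun m : ℕ => 1 - ρ ^ 2 ^ m) Filter.atTop (nhds (1 - 0)) :=
      ((tendsto_pow_atTop_nhds_zero_of_lt_one hρ0.le hρ1).comp hpow).const_sub 1
    simpa using h1.log (by norm_num)
  have hs : Filter.Tendsto s Filter.atTop (nhds ρ) := by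
    have h2 := hlog.div_atTop (tendsto_pow_atTop_atTop_of_one_lt (one_lt_two : (1 : ℝ) < 2))
    simpa using (h2.const_mul ((1 - ρ ^ 2) / ρ)).const_sub ρ
  exact ge_of_tendsto' (ENNReal.tendsto_ofReal ((hs.pow 2).const_mul Real.pi)) hbound

/-- For a sense-preserving univalent harmonic self-mapping of the
unit disk, the Jacobian integral over the disk of radius `r` is at most `π r²`. -/
theorem jacobian_integral_bound
    (h g : ℂ → ℂ)
    (hh : DifferentiableOn ℂ h (ball (0 : ℂ) 1))
    (hg : DifferentiableOn ℂ g (ball (0 : ℂ) 1))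
    (f : ℂ → ℂ) (hf : f = fun z => h z + (starRingEnd ℂ) (g z))
    (hinj : Set.InjOn f (ball (0 : ℂ) 1))
    (hself : Set.MapsTo f (ball (0 : ℂ) 1) (ball (0 : ℂ) 1))
    (hsp : ∀ z ∈ ball (0 : ℂ) 1, ‖deriv g z‖ < ‖deriv h z‖)
    (r : ℝ) (hr0 : 0 < r) (hr1 : r < 1) :
    (∫⁻ z in ball (0 : ℂ) r, ENNReal.ofReal (‖deriv h z‖ ^ 2 - ‖deriv g z‖ ^ 2))
      ≤ ENNReal.ofReal (Real.pi * r ^ 2) := by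
  have hsub : ball (0 : ℂ) r ⊆ ball 0 1 := ball_subset_ball hr1.le
  rw [lintegral_jacobian_eq_volume_image isOpen_ball (hh.mono hsub) (hg.mono hsub) hf
    (hinj.mono hsub) fun z hz => hsp z (hsub hz)]
  have hR : ∀ᶠ R in nhdsWithin (1 : ℝ) (Set.Iio 1),
      volume (f '' ball 0 r) ≤ ENNReal.ofReal (Real.pi * (r / R) ^ 2) := by
    filter_upwards [Ioo_mem_nhdsLT hr1] with R hR
    have hR0 : 0 < R := hr0.trans hR.1
    refine le_trans ?_ (volume_image_closedBall_le hh hg hf hself hR0 hR.2 (div_pos hr0 hR0)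
      ((div_lt_one hR0).2 hR.1))
    rw [mul_div_cancel₀ _ hR0.ne']
    exact measure_mono (Set.image_mono ball_subset_closedBall)
  have hlim : Filter.Tendsto (fun R : ℝ => Real.pi * (r / R) ^ 2)
      (nhdsWithin (1 : ℝ) (Set.Iio 1)) (nhds (Real.pi * (r / 1) ^ 2)) := by
    refine Filter.Tendsto.mono_left (ContinuousAt.tendsto ?_) nhdsWithin_le_nhds
    fun_prop (disch := norm_num)
  rw [div_one] at hlim
  exact ge_of_tendsto (ENNReal.tendsto_ofReal hlim) hR
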